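/- Let G be a generic two-by-two game and let (ν,μ) be a mixed-strategy Nash equilibrium of G^Q. Suppose μ is supported on the set {1, u, v, u·v}, where u and v are unit quaternions with u² = v² = −1 and u·v + v·u = 0. If ν is supported on four pairwise orthogonal unit quaternions, each of which has positive ν-measure, then μ({1}) = μ({u}) = μ({v}) = μ({u·v}) = 1/4. -/

import Mathlib

noncomputable section

open MeasureTheory

local notation "ℍ" => Quaternion ℝ

instance : MeasurableSpace (Quaternion ℝ) := borel _
instance : BorelSpace (Quaternion ℝ) := ⟨rfl⟩

/-- The four real coordinates of a quaternion: `p = π₁(p) + π₂(p)i + π₃(p)j + π₄(p)k`. -/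
def piQ (t : Fin 4) (p : ℍ) : ℝ := ![p.re, p.imI, p.imJ, p.imK] t

/-- The standard inner product on ℍ ≅ ℝ⁴. -/
def qinner (p q : ℍ) : ℝ := ∑ t : Fin 4, piQ t p * piQ t q

/-- The quaternions `i`, `j`, `k`. -/
def qI : ℍ := ⟨0, 1, 0, 0⟩
def qJ : ℍ := ⟨0, 0, 1, 0⟩
def qK : ℍ := ⟨0, 0, 0, 1⟩

/-- A mixed quantum strategy: a Borel probability measure on the unit quaternions. -/
def IsMixed (μ : Measure ℍ) : Prop :=
  IsProbabilityMeasure μ ∧ μ {p : ℍ | ‖p‖ = 1} = 1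

/-- Quantum payoff with payoff vector `X`: `P^Q(p,q) = Σ_t π_t(pq)² X_t`. -/
def payoff (X : Fin 4 → ℝ) (p q : ℍ) : ℝ :=
  ∑ t : Fin 4, (piQ t (p * q)) ^ 2 * X t

/-- Expected payoff of a pair of mixed strategies. -/
def payoffM (X : Fin 4 → ℝ) (ν μ : Measure ℍ) : ℝ :=
  ∫ p, ∫ q, payoff X p q ∂μ ∂ν

/-- Mixed-strategy Nash equilibrium of the quantum game with payoff vectors `X`, `Y`. -/
def IsNash (X Y : Fin 4 → ℝ) (ν μ : Measure ℍ) : Prop :=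
  IsMixed ν ∧ IsMixed μ ∧
    (∀ ν' : Measure ℍ, IsMixed ν' → payoffM X ν' μ ≤ payoffM X ν μ) ∧
    (∀ μ' : Measure ℍ, IsMixed μ' → payoffM Y ν μ' ≤ payoffM Y ν μ)

/-- Equivalence of mixed quantum strategies. -/
def StratEquiv (μ μ' : Measure ℍ) : Prop :=
  ∀ p : ℍ, ‖p‖ = 1 → ∀ t : Fin 4,
    ∫ q, (piQ t (p * q)) ^ 2 ∂μ = ∫ q, (piQ t (p * q)) ^ 2 ∂μ'

/-- Equivalence of pairs of mixed strategies: `(ν,μ) ∼ (ν',μ')` iff there is a unit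
quaternion `u` with `ν' ∼ ν·u` and `μ' ∼ u⁻¹·μ`. -/
def PairEquiv (ν μ ν' μ' : Measure ℍ) : Prop :=
  ∃ u : ℍ, ‖u‖ = 1 ∧
    StratEquiv (Measure.map (fun p => p * u) ν) ν' ∧
    StratEquiv (Measure.map (fun q => u⁻¹ * q) μ) μ'

/-- A generic two-by-two game: all payoffs distinct and all pairwise sums distinct. -/
def Generic (X Y : Fin 4 → ℝ) : Prop :=
  Function.Injective X ∧ Function.Injective Y ∧
    (∀ s t s' t' : Fin 4, s < t → s' < t' → X s + X t = X s' + X t' → s = s' ∧ t = t') ∧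
    (∀ s t s' t' : Fin 4, s < t → s' < t' → Y s + Y t = Y s' + Y t' → s = s' ∧ t = t')

/-- `K(p) = π₁(p)π₂(p)π₃(p)π₄(p)`. -/
def K (p : ℍ) : ℝ := p.re * p.imI * p.imJ * p.imK

/-- Intertwined quadruple of quaternions. -/
def Intertwined (p q r s : ℍ) : Prop :=
  ∃ α : ℝ, α ≠ 0 ∧ ∀ X Y : ℝ, α * K (X • p + Y • q) = K (X • r + Y • s)

/-- Fully intertwined quadruple of quaternions. -/
def FullyIntertwined (p q r s : ℍ) : Prop :=
  Intertwined p q r s ∧ Intertwined p r q s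

/-- `p` is an optimal response for Player One to the mixed strategy `μ`. -/
def Optimal₁ (X : Fin 4 → ℝ) (μ : Measure ℍ) (p : ℍ) : Prop :=
  ‖p‖ = 1 ∧ ∀ p' : ℍ, ‖p'‖ = 1 → ∫ q, payoff X p' q ∂μ ≤ ∫ q, payoff X p q ∂μ

/-- `q` is an optimal response for Player Two to the mixed strategy `ν`. -/
def Optimal₂ (Y : Fin 4 → ℝ) (ν : Measure ℍ) (q : ℍ) : Prop :=
  ‖q‖ = 1 ∧ ∀ q' : ℍ, ‖q'‖ = 1 → ∫ p, payoff Y p q' ∂ν ≤ ∫ p, payoff Y p q ∂ν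

theorem qI_re : qI.re = 0 := rfl
theorem qI_imI : qI.imI = 1 := rfl
theorem qI_imJ : qI.imJ = 0 := rfl
theorem qI_imK : qI.imK = 0 := rfl
theorem qJ_re : qJ.re = 0 := rfl
theorem qJ_imI : qJ.imI = 0 := rfl
theorem qJ_imJ : qJ.imJ = 1 := rfl
theorem qJ_imK : qJ.imK = 0 := rfl
theorem qK_re : qK.re = 0 := rfl
theorem qK_imI : qK.imI = 0 := rfl
theorem qK_imJ : qK.imJ = 0 := rfl
theorem qK_imK : qK.imK = 1 := rfl

theorem payoff_eq (X : Fin 4 → ℝ) (p c : ℍ) :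
    payoff X p c = (p * c).re ^ 2 * X 0 + (p * c).imI ^ 2 * X 1 + (p * c).imJ ^ 2 * X 2 +
      (p * c).imK ^ 2 * X 3 := by
  simp [payoff, piQ, Fin.sum_univ_four]

theorem payoff_smul (X : Fin 4 → ℝ) (r : ℝ) (p c : ℍ) :
    payoff X (r • p) c = r ^ 2 * payoff X p c := by
  simp [payoff, piQ, Fin.sum_univ_four]
  ring

/-- The payoffs along the orthogonal frame `p, ip, jp, kp` add up to the total payoff. -/
theorem payoff_add_frame (X : Fin 4 → ℝ) (p c : ℍ) :
    payoff X p c + payoff X (qI * p) c + payoff X (qJ * p) c + payoff X (qK * p) c =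
      (∑ t, X t) * (Quaternion.normSq p * Quaternion.normSq c) := by
  simp only [payoff_eq, Fin.sum_univ_four, Quaternion.normSq_def', Quaternion.re_mul,
    Quaternion.imI_mul, Quaternion.imJ_mul, Quaternion.imK_mul, qI_re, qI_imI, qI_imJ, qI_imK,
    qJ_re, qJ_imI, qJ_imJ, qJ_imK, qK_re, qK_imI, qK_imJ, qK_imK]
  ring

theorem qinner_mul_right (p q c : ℍ) :
    qinner (p * c) (q * c) = qinner p q * Quaternion.normSq c := by
  simp [qinner, piQ, Fin.sum_univ_four, Quaternion.normSq_def']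
  ring

theorem qinner_self (p : ℍ) : qinner p p = ‖p‖ ^ 2 := by
  rw [pow_two, ← Quaternion.normSq_eq_norm_mul_self]
  simp [qinner, piQ, Fin.sum_univ_four, Quaternion.normSq_def']
  ring

/-- The payoffs along any orthonormal frame add up to the total payoff. -/
theorem sum_payoff_orthonormal (X : Fin 4 → ℝ) (q : Fin 4 → ℍ) (hq1 : ∀ i, ‖q i‖ = 1)
    (hq2 : ∀ i j, i ≠ j → qinner (q i) (q j) = 0) (c : ℍ) (hc : ‖c‖ = 1) :
    ∑ i, payoff X (q i) c = ∑ t, X t := by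
  let A : Matrix (Fin 4) (Fin 4) ℝ := fun i t => piQ t (q i * c)
  have hA : A * A.transpose = 1 := by
    ext i j
    have h : (A * A.transpose) i j = qinner (q i * c) (q j * c) := rfl
    rw [h, qinner_mul_right, Quaternion.normSq_eq_norm_mul_self, hc]
    by_cases hij : i = j
    · subst hij
      simp [qinner_self, hq1]
    · simp [hij, hq2 i j hij]
  have hA' := mul_eq_one_comm.mp hA
  have hcol : ∀ t, ∑ i, piQ t (q i * c) ^ 2 = 1 := by
    intro t
    have h := congrFun (congrFun hA' t) t
    rw [Matrix.mul_apply, Matrix.one_apply_eq] at h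
    simp only [pow_two]
    exact h
  simp only [payoff]
  rw [Finset.sum_comm]
  refine Finset.sum_congr rfl fun t _ => ?_
  rw [← Finset.sum_mul, hcol, one_mul]

/-- The pairing of the quadratic form `f` with the operator `e ↦ a e b`. -/
def framePairing (f : ℍ → ℝ) (a b : ℍ) : ℝ :=
  (f (1 + a * 1 * b) - f (1 - a * 1 * b)) + (f (qI + a * qI * b) - f (qI - a * qI * b)) +
    (f (qJ + a * qJ * b) - f (qJ - a * qJ * b)) + (f (qK + a * qK * b) - f (qK - a * qK * b))

theorem framePairing_qI (X : Fin 4 → ℝ) (b c : ℍ) (hb : b.re = 0) :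
    framePairing (fun p => payoff X p c) qI b =
      4 * (X 2 + X 3 - X 0 - X 1) * (star c * b * c).imI := by
  simp only [framePairing, payoff_eq, Quaternion.re_add, Quaternion.imI_add, Quaternion.imJ_add,
    Quaternion.imK_add, Quaternion.re_sub, Quaternion.imI_sub, Quaternion.imJ_sub,
    Quaternion.imK_sub, Quaternion.re_mul, Quaternion.imI_mul, Quaternion.imJ_mul,
    Quaternion.imK_mul, Quaternion.re_one, Quaternion.imI_one, Quaternion.imJ_one,
    Quaternion.imK_one, Quaternion.re_star, Quaternion.imI_star, Quaternion.imJ_star,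
    Quaternion.imK_star, qI_re, qI_imI, qI_imJ, qI_imK, qJ_re, qJ_imI, qJ_imJ, qJ_imK, qK_re,
    qK_imI, qK_imJ, qK_imK, hb]
  ring

theorem framePairing_qJ (X : Fin 4 → ℝ) (b c : ℍ) (hb : b.re = 0) :
    framePairing (fun p => payoff X p c) qJ b =
      4 * (X 1 + X 3 - X 0 - X 2) * (star c * b * c).imJ := by
  simp only [framePairing, payoff_eq, Quaternion.re_add, Quaternion.imI_add, Quaternion.imJ_add,
    Quaternion.imK_add, Quaternion.re_sub, Quaternion.imI_sub, Quaternion.imJ_sub,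
    Quaternion.imK_sub, Quaternion.re_mul, Quaternion.imI_mul, Quaternion.imJ_mul,
    Quaternion.imK_mul, Quaternion.re_one, Quaternion.imI_one, Quaternion.imJ_one,
    Quaternion.imK_one, Quaternion.re_star, Quaternion.imI_star, Quaternion.imJ_star,
    Quaternion.imK_star, qI_re, qI_imI, qI_imJ, qI_imK, qJ_re, qJ_imI, qJ_imJ, qJ_imK, qK_re,
    qK_imI, qK_imJ, qK_imK, hb]
  ring

theorem framePairing_qK (X : Fin 4 → ℝ) (b c : ℍ) (hb : b.re = 0) :
    framePairing (fun p => payoff X p c) qK b =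
      4 * (X 1 + X 2 - X 0 - X 3) * (star c * b * c).imK := by
  simp only [framePairing, payoff_eq, Quaternion.re_add, Quaternion.imI_add, Quaternion.imJ_add,
    Quaternion.imK_add, Quaternion.re_sub, Quaternion.imI_sub, Quaternion.imJ_sub,
    Quaternion.imK_sub, Quaternion.re_mul, Quaternion.imI_mul, Quaternion.imJ_mul,
    Quaternion.imK_mul, Quaternion.re_one, Quaternion.imI_one, Quaternion.imJ_one,
    Quaternion.imK_one, Quaternion.re_star, Quaternion.imI_star, Quaternion.imJ_star,
    Quaternion.imK_star, qI_re, qI_imI, qI_imJ, qI_imK, qJ_re, qJ_imI, qJ_imJ, qJ_imK, qK_re,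
    qK_imI, qK_imJ, qK_imK, hb]
  ring

theorem framePairing_normSq (V : ℝ) (a b : ℍ) (ha : a.re = 0) (hb : b.re = 0) :
    framePairing (fun p => V * Quaternion.normSq p) a b = 0 := by
  simp only [framePairing, Quaternion.normSq_def', Quaternion.re_add, Quaternion.imI_add,
    Quaternion.imJ_add, Quaternion.imK_add, Quaternion.re_sub, Quaternion.imI_sub,
    Quaternion.imJ_sub, Quaternion.imK_sub, Quaternion.re_mul, Quaternion.imI_mul,
    Quaternion.imJ_mul, Quaternion.imK_mul, Quaternion.re_one, Quaternion.imI_one,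
    Quaternion.imJ_one, Quaternion.imK_one, qI_re, qI_imI, qI_imJ, qI_imK, qJ_re, qJ_imI, qJ_imJ,
    qJ_imK, qK_re, qK_imI, qK_imJ, qK_imK, ha, hb]
  ring

theorem framePairing_sum (m : Fin 4 → ℝ) (f : Fin 4 → ℍ → ℝ) (a b : ℍ) :
    framePairing (fun p => ∑ j, m j * f j p) a b = ∑ j, m j * framePairing (f j) a b := by
  simp only [framePairing, Fin.sum_univ_four]
  ring

/-- If the averaged payoff is a multiple of the norm form, then the corresponding average of
the rotations `b ↦ star c * b * c` vanishes. -/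
theorem sum_conj_eq_zero (X : Fin 4 → ℝ)
    (hX : ∀ s t s' t' : Fin 4, s < t → s' < t' → X s + X t = X s' + X t' → s = s' ∧ t = t')
    (m : Fin 4 → ℝ) (c : Fin 4 → ℍ) (V : ℝ)
    (hV : ∀ p, ∑ j, m j * payoff X p (c j) = V * Quaternion.normSq p)
    (b : ℍ) (hb : b.re = 0) : ∑ j, m j • (star (c j) * b * c j) = 0 := by
  have key : ∀ a : ℍ, a.re = 0 →
      ∑ j, m j * framePairing (fun p => payoff X p (c j)) a b = 0 := by
    intro a ha
    rw [← framePairing_sum m (fun j p => payoff X p (c j)), funext hV]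
    exact framePairing_normSq V a b ha hb
  have hI : X 2 + X 3 - X 0 - X 1 ≠ 0 := fun h =>
    absurd (hX 0 1 2 3 (by decide) (by decide) (by linarith)).1 (by decide)
  have hJ : X 1 + X 3 - X 0 - X 2 ≠ 0 := fun h =>
    absurd (hX 0 2 1 3 (by decide) (by decide) (by linarith)).1 (by decide)
  have hK : X 1 + X 2 - X 0 - X 3 ≠ 0 := fun h =>
    absurd (hX 0 3 1 2 (by decide) (by decide) (by linarith)).1 (by decide)
  have kI := key qI rfl
  have kJ := key qJ rfl
  have kK := key qK rfl
  simp only [framePairing_qI X b _ hb] at kI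
  simp only [framePairing_qJ X b _ hb] at kJ
  simp only [framePairing_qK X b _ hb] at kK
  rw [Fin.sum_univ_four] at kI kJ kK ⊢
  ext
  · simp only [Quaternion.re_add, Quaternion.re_smul, Quaternion.re_mul, Quaternion.imI_mul,
      Quaternion.imJ_mul, Quaternion.imK_mul, Quaternion.re_star, Quaternion.imI_star,
      Quaternion.imJ_star, Quaternion.imK_star, Quaternion.re_zero, smul_eq_mul, hb]
    ring
  · refine mul_left_cancel₀ (mul_ne_zero four_ne_zero hI) ?_
    simp only [Quaternion.imI_add, Quaternion.imI_smul, Quaternion.imI_zero, smul_eq_mul]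
    linear_combination kI
  · refine mul_left_cancel₀ (mul_ne_zero four_ne_zero hJ) ?_
    simp only [Quaternion.imJ_add, Quaternion.imJ_smul, Quaternion.imJ_zero, smul_eq_mul]
    linear_combination kJ
  · refine mul_left_cancel₀ (mul_ne_zero four_ne_zero hK) ?_
    simp only [Quaternion.imK_add, Quaternion.imK_smul, Quaternion.imK_zero, smul_eq_mul]
    linear_combination kK

/-- Integration against a probability measure carried by finitely many distinct points. -/
theorem integral_eq_sum_of_range (μ : Measure ℍ) [IsProbabilityMeasure μ] (c : Fin 4 → ℍ)
    (hc : Function.Injective c) (h : μ (Set.range c) = 1) (f : ℍ → ℝ) :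
    ∫ x, f x ∂μ = ∑ i, μ.real {c i} * f (c i) := by
  classical
  have hs : ((Finset.univ.image c : Finset ℍ) : Set ℍ) = Set.range c := by simp
  have hr : μ.restrict (Finset.univ.image c : Finset ℍ) = μ := by
    rw [hs]
    refine Measure.restrict_eq_self_of_ae_mem ?_
    exact (mem_ae_iff_prob_eq_one (Set.finite_range c).measurableSet).2 h
  calc ∫ x, f x ∂μ = ∫ x in (Finset.univ.image c : Finset ℍ), f x ∂μ := by rw [hr]
    _ = ∑ x ∈ Finset.univ.image c, μ.real {x} • f x := setIntegral_finset _ IntegrableOn.finset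
    _ = _ := by rw [Finset.sum_image fun i _ j _ hij => hc hij]; rfl

theorem sum_real_singleton (μ : Measure ℍ) [IsProbabilityMeasure μ] (c : Fin 4 → ℍ)
    (hc : Function.Injective c) (h : μ (Set.range c) = 1) : ∑ i, μ.real {c i} = 1 := by
  simpa using (integral_eq_sum_of_range μ c hc h fun _ => 1).symm

/-- Against a four-point strategy of the second player, an equilibrium strategy of the first
player carried by an orthonormal frame with full support makes all payoffs equal. -/
theorem payoff_eq_normSq_of_nash (X Y : Fin 4 → ℝ) (ν μ : Measure ℍ) (hnash : IsNash X Y ν μ)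
    (c : Fin 4 → ℍ) (hc : Function.Injective c) (hc1 : ∀ j, ‖c j‖ = 1)
    (hμ : μ (Set.range c) = 1) (q : Fin 4 → ℍ) (hq1 : ∀ i, ‖q i‖ = 1)
    (hq2 : ∀ i j, i ≠ j → qinner (q i) (q j) = 0)
    (hν : ν (Set.range q) = 1) (hpos : ∀ i, 0 < ν {q i}) :
    ∃ V : ℝ, ∀ p, ∑ j, μ.real {c j} * payoff X p (c j) = V * Quaternion.normSq p := by
  obtain ⟨⟨hνp, -⟩, ⟨hμp, -⟩, hdev, -⟩ := hnash
  have hq : Function.Injective q := by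
    intro i j hij
    by_contra hne
    have h := hq2 i j hne
    rw [hij, qinner_self, hq1] at h
    norm_num at h
  set Q : ℍ → ℝ := fun p => ∑ j, μ.real {c j} * payoff X p (c j) with hQ
  have hQint : ∀ p, ∫ x, payoff X p x ∂μ = Q p := fun p =>
    integral_eq_sum_of_range μ c hc hμ _
  have hm := sum_real_singleton μ c hc hμ
  have hn := sum_real_singleton ν q hq hν
  set V : ℝ := payoffM X ν μ with hV
  have hVsum : V = ∑ i, ν.real {q i} * Q (q i) := by
    simp only [hV, payoffM, hQint]
    exact integral_eq_sum_of_range ν q hq hν Q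
  have hle : ∀ p : ℍ, ‖p‖ = 1 → Q p ≤ V := by
    intro p hp
    have h := hdev (Measure.dirac p) ⟨inferInstance, by
      rw [Measure.dirac_apply_of_mem]
      exact hp⟩
    simpa only [payoffM, hQint, integral_dirac] using h
  have hQq : ∀ i, Q (q i) = V := by
    have h0 : ∑ i, ν.real {q i} * (V - Q (q i)) = 0 := by
      simp only [mul_sub, Finset.sum_sub_distrib, ← Finset.sum_mul]
      rw [hn, ← hVsum]
      ring
    have hnn : ∀ i ∈ Finset.univ, 0 ≤ ν.real {q i} * (V - Q (q i)) := fun i _ =>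
      mul_nonneg measureReal_nonneg (sub_nonneg.2 (hle _ (hq1 i)))
    intro i
    have hi := (Finset.sum_eq_zero_iff_of_nonneg hnn).1 h0 i (Finset.mem_univ i)
    have hpi : 0 < ν.real {q i} := ENNReal.toReal_pos (hpos i).ne' (measure_ne_top _ _)
    rcases mul_eq_zero.1 hi with h | h <;> linarith
  have htot : 4 * V = ∑ t, X t := by
    calc 4 * V = ∑ i, Q (q i) := by simp [hQq]
      _ = ∑ j, μ.real {c j} * ∑ i, payoff X (q i) (c j) := by
        simp only [hQ, Finset.mul_sum]
        exact Finset.sum_comm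
      _ = ∑ t, X t := by
        simp only [sum_payoff_orthonormal X q hq1 hq2 _ (hc1 _)]
        rw [← Finset.sum_mul, hm, one_mul]
  have hunit : ∀ p : ℍ, ‖p‖ = 1 → Q p = V := by
    intro p hp
    have hsum : Q p + Q (qI * p) + Q (qJ * p) + Q (qK * p) = 4 * V := by
      simp only [hQ, ← Finset.sum_add_distrib, ← mul_add, payoff_add_frame,
        Quaternion.normSq_eq_norm_mul_self, hp, hc1]
      rw [← Finset.sum_mul, hm, htot]
      ring
    have hnorm : ∀ e : ℍ, Quaternion.normSq e = 1 → ‖e * p‖ = 1 := by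
      intro e he
      rw [Quaternion.normSq_eq_norm_mul_self, mul_self_eq_one_iff] at he
      have he' : ‖e‖ = 1 := he.resolve_right (by linarith [norm_nonneg e])
      rw [norm_mul, he', hp, one_mul]
    have h1 := hle p hp
    have h2 := hle _ (hnorm qI (by simp [Quaternion.normSq_def', qI_re, qI_imI, qI_imJ, qI_imK]))
    have h3 := hle _ (hnorm qJ (by simp [Quaternion.normSq_def', qJ_re, qJ_imI, qJ_imJ, qJ_imK]))
    have h4 := hle _ (hnorm qK (by simp [Quaternion.normSq_def', qK_re, qK_imI, qK_imJ, qK_imK]))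
    linarith
  refine ⟨V, fun p => ?_⟩
  change Q p = _
  have hsmul : ∀ (r : ℝ) (p : ℍ), Q (r • p) = r ^ 2 * Q p := by
    intro r p
    simp only [hQ, payoff_smul, Finset.mul_sum]
    exact Finset.sum_congr rfl fun j _ => by ring
  by_cases hp : p = 0
  · subst hp
    simpa using hsmul 0 0
  · have hp' : ‖p‖ ≠ 0 := norm_ne_zero_iff.2 hp
    have h := hsmul ‖p‖ (‖p‖⁻¹ • p)
    have hn1 : ‖‖p‖⁻¹ • p‖ = 1 := by rw [norm_smul, norm_inv, norm_norm, inv_mul_cancel₀ hp']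
    rw [smul_inv_smul₀ hp', hunit _ hn1] at h
    rw [h, Quaternion.normSq_eq_norm_mul_self]
    ring

theorem star_eq_neg_of_sq (u : ℍ) (hu : ‖u‖ = 1) (hu2 : u ^ 2 = -1) : star u = -u := by
  have hu' : u * star u = 1 := by
    rw [Quaternion.self_mul_star, Quaternion.normSq_eq_norm_mul_self, hu]
    simp
  have hu0 : u ≠ 0 := norm_ne_zero_iff.1 (by rw [hu]; exact one_ne_zero)
  refine mul_left_cancel₀ hu0 ?_
  rw [hu', mul_neg, ← pow_two, hu2, neg_neg]

theorem re_eq_zero_of_star_eq_neg (u : ℍ) (h : star u = -u) : u.re = 0 := by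
  have := congrArg (fun x : ℍ => x.re) h
  simp at this
  linarith

/-- If `μ` is supported on `{1, u, v, u·v}` and `ν` is supported on four
pairwise orthogonal unit quaternions, each of positive `ν`-measure, then `μ` assigns
probability 1/4 to each of `1, u, v, u·v`. -/
theorem four_point_support_forces_quarter (X Y : Fin 4 → ℝ) (hG : Generic X Y)
    (ν μ : Measure ℍ) (hnash : IsNash X Y ν μ)
    (u v : ℍ) (hu : ‖u‖ = 1) (hv : ‖v‖ = 1)
    (hu2 : u ^ 2 = -1) (hv2 : v ^ 2 = -1) (huv : u * v + v * u = 0)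
    (hμsupp : μ ({1, u, v, u * v} : Set ℍ) = 1)
    (q : Fin 4 → ℍ) (hq1 : ∀ i, ‖q i‖ = 1)
    (hq2 : ∀ i j, i ≠ j → qinner (q i) (q j) = 0)
    (hνsupp : ν (Set.range q) = 1) (hpos : ∀ i, 0 < ν {q i}) :
    μ {(1 : ℍ)} = 1/4 ∧ μ {u} = 1/4 ∧ μ {v} = 1/4 ∧ μ {u * v} = 1/4 := by
  have hp : IsProbabilityMeasure μ := hnash.2.1.1
  have uu : u * u = -1 := by rw [← pow_two, hu2]
  have vv : v * v = -1 := by rw [← pow_two, hv2]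
  have vu : v * u = -(u * v) := eq_neg_of_add_eq_zero_right huv
  have su := star_eq_neg_of_sq u hu hu2
  have sv := star_eq_neg_of_sq v hv hv2
  have ru := re_eq_zero_of_star_eq_neg u su
  have rv := re_eq_zero_of_star_eq_neg v sv
  have u0 : u ≠ 0 := norm_ne_zero_iff.1 (by rw [hu]; exact one_ne_zero)
  have v0 : v ≠ 0 := norm_ne_zero_iff.1 (by rw [hv]; exact one_ne_zero)
  have suv : star (u * v) = -(u * v) := by rw [star_mul, su, sv, neg_mul_neg, vu]
  have ruv := re_eq_zero_of_star_eq_neg _ suv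
  have h1u : (1 : ℍ) ≠ u := fun h => by simp [← h, Quaternion.re_one] at ru
  have h1v : (1 : ℍ) ≠ v := fun h => by simp [← h, Quaternion.re_one] at rv
  have h1uv : (1 : ℍ) ≠ u * v := fun h => by simp [← h, Quaternion.re_one] at ruv
  have h_uv : u ≠ v := fun h => by
    rw [← h, uu, Quaternion.re_neg, Quaternion.re_one] at ruv
    norm_num at ruv
  have h_u_uv : u ≠ u * v := fun h => h1v (mul_left_cancel₀ u0 (by rw [mul_one]; exact h))
  have h_v_uv : v ≠ u * v := fun h => h1u (mul_right_cancel₀ v0 (by rw [one_mul]; exact h))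
  let c : Fin 4 → ℍ := ![1, u, v, u * v]
  have hc : Function.Injective c := by
    intro i j hij
    fin_cases i <;> fin_cases j <;> simp_all [c]
  have hrange : Set.range c = {1, u, v, u * v} := by
    ext x
    simp [c, eq_comm]
    tauto
  have hc1 : ∀ j, ‖c j‖ = 1 := by
    intro j
    fin_cases j <;> simp [c, hu, hv]
  have hμc : μ (Set.range c) = 1 := by rw [hrange, hμsupp]
  obtain ⟨V, hV⟩ := payoff_eq_normSq_of_nash X Y ν μ hnash c hc hc1 hμc q hq1 hq2 hνsupp hpos
  have htot := sum_real_singleton μ c hc hμc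
  have hrot := sum_conj_eq_zero X hG.2.2.1 (fun j => μ.real {c j}) c V hV
  have eu := hrot u ru
  have ev := hrot v rv
  simp only [Fin.sum_univ_four, c, Matrix.cons_val, star_one, su, sv, suv, one_mul, mul_one]
    at eu ev htot
  have e1 : -u * u * u = u := by rw [neg_mul, uu]; simp
  have e2 : -v * u * v = -u := by rw [neg_mul, vu, neg_neg, mul_assoc, vv]; simp
  have e3 : -(u * v) * u * (u * v) = -u := by
    rw [neg_mul, mul_assoc u v u, vu, mul_neg, neg_neg, ← mul_assoc u u v, uu, neg_one_mul,
      neg_mul, ← mul_assoc v u v, vu, neg_mul, neg_neg, mul_assoc, vv]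
    simp
  have f1 : -u * v * u = -v := by
    rw [neg_mul, neg_mul, mul_assoc, vu, mul_neg, neg_neg, ← mul_assoc, uu, neg_one_mul]
  have f2 : -v * v * v = v := by rw [neg_mul, vv]; simp
  have f3 : -(u * v) * v * (u * v) = -v := by
    rw [neg_mul, mul_assoc u v v, vv, mul_neg, mul_one, neg_neg, ← mul_assoc, uu, neg_one_mul]
  rw [e1, e2, e3] at eu
  rw [f1, f2, f3] at ev
  have gu : μ.real {1} + μ.real {u} - μ.real {v} - μ.real {u * v} = 0 := by
    refine (smul_eq_zero.1 (?_ : _ • u = 0)).resolve_right u0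
    rw [← eu]
    module
  have gv : μ.real {1} - μ.real {u} + μ.real {v} - μ.real {u * v} = 0 := by
    refine (smul_eq_zero.1 (?_ : _ • v = 0)).resolve_right v0
    rw [← ev]
    module
  have guv : μ.real {1} - μ.real {u} - μ.real {v} + μ.real {u * v} = 0 := by
    have euv := hrot (u * v) ruv
    simp only [Fin.sum_univ_four, c, Matrix.cons_val, star_one, su, sv, suv, one_mul, mul_one]
      at euv
    have g1 : -u * (u * v) * u = -(u * v) := by
      rw [neg_mul, ← mul_assoc, uu, neg_one_mul, neg_neg, vu]
    have g2 : -v * (u * v) * v = -(u * v) := by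
      rw [mul_assoc, mul_assoc, vv, mul_neg, mul_one, neg_mul_neg, vu]
    have g3 : -(u * v) * (u * v) * (u * v) = u * v := by
      rw [← suv, Quaternion.star_mul_self, Quaternion.normSq_eq_norm_mul_self, norm_mul, hu, hv]
      simp
    rw [g1, g2, g3] at euv
    refine (smul_eq_zero.1 (?_ : _ • (u * v) = 0)).resolve_right (mul_ne_zero u0 v0)
    rw [← euv]
    module
  have hquarter : ∀ s : Set ℍ, μ.real s = 1 / 4 → μ s = 1 / 4 := by
    intro s hs
    rw [← ENNReal.ofReal_toReal (measure_ne_top μ s)]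
    change ENNReal.ofReal (μ.real s) = _
    rw [hs, ENNReal.ofReal_div_of_pos (by norm_num)]
    simp
  refine ⟨hquarter _ ?_, hquarter _ ?_, hquarter _ ?_, hquarter _ ?_⟩ <;> linarith
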